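/- For every integer ℓ ≥ 1 and m = 2ℓ, the following identity of formal power series in ℚ[[t]] holds: ∑_{n≥0} i_n^{(m)} · t^n/n! = det( I_{i−j} + I_{i+j−1} )_{1≤i,j≤ℓ}, where i_n^{(m)} denotes the number of involutions in I_n^{(m)}. -/

import Mathlib

open scoped Classical

noncomputable section

/-- `f` has a descending subsequence of length `k`. -/
def HasDescSeq {n : ℕ} (f : Fin n → Fin n) (k : ℕ) : Prop :=
  ∃ s : Fin k → Fin n, StrictMono s ∧ StrictAnti fun a => f (s a)

/-- The number of involutions of `{1,…,n}` with no descending subsequence of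
length `m+1`, i.e. the cardinality of `I_n^{(m)}`. -/
def invCount (m n : ℕ) : ℕ :=
  Nat.card {τ : Equiv.Perm (Fin n) //
    Function.Involutive ⇑τ ∧ ¬ HasDescSeq (⇑τ) (m + 1)}

/-- The formal power series `I_i = ∑_{n ≥ max(0,−i)} t^{2n+i}/(n!·(n+i)!)` in `ℚ[[t]]`. -/
def besselI (i : ℤ) : PowerSeries ℚ :=
  PowerSeries.mk fun N =>
    if 0 ≤ (N : ℤ) - i ∧ 0 ≤ (N : ℤ) + i ∧ 2 ∣ ((N : ℤ) - i) then
      1 / ((Nat.factorial (((N : ℤ) - i) / 2).toNat : ℚ) *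
           (Nat.factorial (((N : ℤ) + i) / 2).toNat : ℚ))
    else 0

lemma besselI_neg (i : ℤ) : besselI (-i) = besselI i := by
  ext N
  simp only [besselI, PowerSeries.coeff_mk, sub_neg_eq_add, ← sub_eq_add_neg]
  exact if_congr (by omega) (by rw [mul_comm]) rfl

lemma coeff_besselI_of_add_eq {i : ℤ} {N p q : ℕ} (hN : p + q = N) (hi : (q : ℤ) - p = i) :
    PowerSeries.coeff N (besselI i) = 1 / ((p.factorial : ℚ) * q.factorial) := by
  subst hN hi
  simp only [besselI, PowerSeries.coeff_mk]
  rw [if_pos (by push_cast; omega)]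
  congr 4 <;> push_cast <;> omega

lemma coeff_besselI_eq_zero {i : ℤ} {N : ℕ} (h : ∀ p q : ℕ, p + q = N → (q : ℤ) - p ≠ i) :
    PowerSeries.coeff N (besselI i) = 0 := by
  simp only [besselI, PowerSeries.coeff_mk]
  refine if_neg fun ⟨h1, h2, h3⟩ => ?_
  exact h (((N : ℤ) - i) / 2).toNat (((N : ℤ) + i) / 2).toNat (by omega) (by omega)

lemma derivative_besselI (i : ℤ) :
    PowerSeries.derivative ℚ (besselI i) = besselI (i - 1) + besselI (i + 1) := by
  ext N
  rw [PowerSeries.coeff_derivative, map_add]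
  by_cases h : ∃ p q : ℕ, p + q = N + 1 ∧ (q : ℤ) - p = i
  · obtain ⟨p, q, hN, hi⟩ := h
    rw [coeff_besselI_of_add_eq hN hi]
    have hpq : (N : ℚ) + 1 = p + q := by exact_mod_cast hN.symm
    rw [hpq]
    have hp : ((p.factorial : ℕ) : ℚ) ≠ 0 := by exact_mod_cast p.factorial_ne_zero
    have hq : ((q.factorial : ℕ) : ℚ) ≠ 0 := by exact_mod_cast q.factorial_ne_zero
    have e1 : PowerSeries.coeff N (besselI (i - 1)) = q / ((p.factorial : ℚ) * q.factorial) := by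
      cases q with
      | zero =>
        rw [coeff_besselI_eq_zero (by intros; omega)]; simp
      | succ q =>
        rw [coeff_besselI_of_add_eq (p := p) (q := q) (by omega) (by push_cast at hi; omega)]
        rw [Nat.factorial_succ]
        push_cast
        have : (q.factorial : ℚ) ≠ 0 := by exact_mod_cast q.factorial_ne_zero
        field_simp
    have e2 : PowerSeries.coeff N (besselI (i + 1)) = p / ((p.factorial : ℚ) * q.factorial) := by
      cases p with
      | zero =>
        rw [coeff_besselI_eq_zero (by intros; omega)]; simp
      | succ p =>
        rw [coeff_besselI_of_add_eq (p := p) (q := q) (by omega) (by push_cast at hi; omega)]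
        rw [Nat.factorial_succ]
        push_cast
        have : (p.factorial : ℚ) ≠ 0 := by exact_mod_cast p.factorial_ne_zero
        field_simp
    rw [e1, e2]
    field_simp
    ring
  · push Not at h
    rw [coeff_besselI_eq_zero h, coeff_besselI_eq_zero, coeff_besselI_eq_zero]
    · simp
    · intro p q hN hi
      exact h (p + 1) q (by omega) (by push_cast; omega)
    · intro p q hN hi
      exact h p (q + 1) (by omega) (by push_cast; omega)

lemma constantCoeff_besselI (i : ℤ) :
    PowerSeries.constantCoeff (besselI i) = if i = 0 then 1 else 0 := by
  rw [← PowerSeries.coeff_zero_eq_constantCoeff_apply]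
  split_ifs with h
  · rw [coeff_besselI_of_add_eq (p := 0) (q := 0) rfl (by simp [h])]; simp
  · exact coeff_besselI_eq_zero (by intros; omega)

lemma Derivation.leibniz_finset_prod {R A ι : Type*} [CommRing R] [CommRing A] [Algebra R A]
    (d : Derivation R A A) (s : Finset ι) (f : ι → A) :
    d (∏ i ∈ s, f i) = ∑ i ∈ s, ∏ j ∈ s, Function.update f i (d (f i)) j := by
  induction s using Finset.induction_on with
  | empty => simp
  | insert a s ha ih =>
    rw [Finset.prod_insert ha, d.leibniz, ih, Finset.sum_insert ha, Finset.prod_insert ha,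
      smul_eq_mul, smul_eq_mul, Finset.mul_sum, add_comm]
    congr 1
    · rw [Function.update_self, mul_comm]
      congr 1
      refine Finset.prod_congr rfl fun j hj => ?_
      rw [Function.update_of_ne (by rintro rfl; exact ha hj)]
    · refine Finset.sum_congr rfl fun i hi => ?_
      rw [Finset.prod_insert ha, Function.update_of_ne (by rintro rfl; exact ha hi)]

lemma Derivation.map_det {R A ι : Type*} [CommRing R] [CommRing A] [Algebra R A]
    [Fintype ι] [DecidableEq ι] (d : Derivation R A A) (M : Matrix ι ι A) :
    d M.det = ∑ i, (M.updateRow i fun k => d (M i k)).det := by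
  simp_rw [← Matrix.det_transpose M, ← Matrix.det_transpose (Matrix.updateRow _ _ _),
    Matrix.det_apply, map_sum]
  rw [Finset.sum_comm]
  refine Finset.sum_congr rfl fun σ _ => ?_
  rw [← Finset.smul_sum, Units.smul_def, Units.smul_def, map_zsmul, d.leibniz_finset_prod]
  congr 1
  refine Finset.sum_congr rfl fun i _ => Finset.prod_congr rfl fun j _ => ?_
  rcases eq_or_ne j i with rfl | h
  · simp
  · simp [h]

/-- The exponential generating function of walks on `ℕ` from `a` to `k` with steps `±1`, where the
step `-1` at `0` stays at `0`. -/
def halfLineKernel (a k : ℤ) : PowerSeries ℚ :=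
  besselI (a - k) + besselI (a + k + 1)

lemma derivative_halfLineKernel (a k : ℤ) :
    PowerSeries.derivative ℚ (halfLineKernel a k) =
      halfLineKernel (a + 1) k + halfLineKernel (a - 1) k := by
  simp only [halfLineKernel, map_add, derivative_besselI]
  ring_nf

lemma halfLineKernel_neg_one (k : ℤ) : halfLineKernel (-1) k = halfLineKernel 0 k := by
  rw [halfLineKernel, halfLineKernel, ← besselI_neg, add_comm, ← besselI_neg (0 - k)]
  ring_nf

/-- The determinant counting families of non-colliding walks on the half line which start at `x`
and end at `0, 1, …, ℓ - 1`. -/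
def slaterDet {ℓ : ℕ} (x : Fin ℓ → ℤ) : PowerSeries ℚ :=
  Matrix.det (Matrix.of fun i k : Fin ℓ => halfLineKernel (x i) k)

lemma updateRow_halfLineKernel {ℓ : ℕ} (x : Fin ℓ → ℤ) (i : Fin ℓ) (a : ℤ) :
    (Matrix.of fun i k : Fin ℓ => halfLineKernel (x i) k).updateRow i
        (fun k => halfLineKernel a k) =
      Matrix.of fun j k : Fin ℓ => halfLineKernel (Function.update x i a j) k := by
  ext1 j k
  rcases eq_or_ne j i with rfl | h
  · simp
  · simp [h]

lemma derivative_slaterDet {ℓ : ℕ} (x : Fin ℓ → ℤ) :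
    PowerSeries.derivative ℚ (slaterDet x) =
      ∑ i, (slaterDet (Function.update x i (x i + 1)) +
        slaterDet (Function.update x i (x i - 1))) := by
  rw [slaterDet, Derivation.map_det]
  refine Finset.sum_congr rfl fun i _ => ?_
  simp only [slaterDet, Matrix.of_apply, derivative_halfLineKernel, ← updateRow_halfLineKernel]
  rw [← Matrix.det_updateRow_add]
  rfl

lemma slaterDet_eq_zero {ℓ : ℕ} {x : Fin ℓ → ℤ} {i j : Fin ℓ} (hij : i ≠ j) (h : x i = x j) :
    slaterDet x = 0 :=
  Matrix.det_zero_of_row_eq hij (by ext1 k; simp [h])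

lemma slaterDet_update_neg_one {ℓ : ℕ} (x : Fin ℓ → ℤ) (i : Fin ℓ) :
    slaterDet (Function.update x i (-1)) = slaterDet (Function.update x i 0) := by
  simp only [slaterDet, ← updateRow_halfLineKernel, halfLineKernel_neg_one]

lemma constantCoeff_slaterDet {ℓ : ℕ} {x : Fin ℓ → ℤ} (hx : StrictMono x) (h0 : ∀ i, 0 ≤ x i) :
    PowerSeries.constantCoeff (slaterDet x) = if ∀ i : Fin ℓ, x i = i then 1 else 0 := by
  have key : PowerSeries.constantCoeff (slaterDet x) =
      Matrix.det (Matrix.of fun i k : Fin ℓ => if x i = k then (1 : ℚ) else 0) := by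
    rw [slaterDet, RingHom.map_det]
    congr 1
    ext i k
    have := h0 i
    simp only [RingHom.mapMatrix_apply, Matrix.map_apply, Matrix.of_apply, halfLineKernel, map_add,
      constantCoeff_besselI, sub_eq_zero]
    rw [if_neg (c := x i + k + 1 = 0) (by omega), add_zero]
  rw [key]
  split_ifs with h
  · rw [← Matrix.det_one (n := Fin ℓ) (R := ℚ)]
    congr 1
    ext i k
    simp [h, Matrix.one_apply, Fin.ext_iff]
  · by_cases hlt : ∀ i, x i < ℓ
    · refine absurd (fun i => ?_) h
      let y : Fin ℓ → Fin ℓ := fun i => ⟨(x i).toNat, by have := h0 i; have := hlt i; omega⟩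
      have hy : StrictMono y := fun i j hij => by
        have := hx hij; have := h0 i; have := h0 j
        simp only [y, Fin.mk_lt_mk]; omega
      have hid : y = id := by
        have h1 : StrictMono (Equiv.ofBijective y (Finite.injective_iff_bijective.1 hy.injective)) :=
          hy
        have := Subsingleton.elim (h1.orderIsoOfSurjective _ (Equiv.surjective _))
          (OrderIso.refl (Fin ℓ))
        ext1 i
        exact congrArg (fun e : Fin ℓ ≃o Fin ℓ => e i) this
      have := congrArg (fun z => ((z i : Fin ℓ) : ℕ)) hid
      have h2 := h0 i
      simp only [y, id] at this
      omega
    · push Not at hlt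
      obtain ⟨i, hi⟩ := hlt
      refine Matrix.det_eq_zero_of_row_eq_zero i fun k => ?_
      have := k.2
      simp only [Matrix.of_apply]
      rw [if_neg (by omega)]

/-- The number of `n`-step walks from `s` to `t` along the relation `R`. -/
def walkCount {S : Type*} (R : S → S → Prop) (n : ℕ) (s t : S) : ℕ :=
  Nat.card {w : Fin (n + 1) → S //
    w 0 = s ∧ w (Fin.last n) = t ∧ ∀ i : Fin n, R (w i.castSucc) (w i.succ)}

lemma walkCount_congr {S T : Type*} {R : S → S → Prop} {Q : T → T → Prop} (e : S ≃ T)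
    (h : ∀ s s', R s s' ↔ Q (e s) (e s')) (n : ℕ) (s t : S) :
    walkCount R n s t = walkCount Q n (e s) (e t) :=
  Nat.card_congr <| (Equiv.arrowCongr (Equiv.refl _) e).subtypeEquiv fun w => by simp [h]

/-- Splitting off the first step of a walk. -/
def walkSuccEquiv {S : Type*} (R : S → S → Prop) (n : ℕ) (s t : S) :
    {w : Fin (n + 1 + 1) → S //
      w 0 = s ∧ w (Fin.last (n + 1)) = t ∧ ∀ i : Fin (n + 1), R (w i.castSucc) (w i.succ)} ≃
    Σ y : {y // R s y}, {w : Fin (n + 1) → S //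
      w 0 = y.1 ∧ w (Fin.last n) = t ∧ ∀ i : Fin n, R (w i.castSucc) (w i.succ)} where
  toFun w := ⟨⟨w.1 1, by have := w.2.2.2 0; rwa [Fin.castSucc_zero, w.2.1] at this⟩,
    ⟨Fin.tail w.1, rfl, w.2.2.1, fun i => w.2.2.2 i.succ⟩⟩
  invFun p := ⟨Fin.cons s p.2.1, rfl, by rw [← Fin.succ_last, Fin.cons_succ]; exact p.2.2.2.1,
    fun i => by
      induction i using Fin.cases with
      | zero => simpa [p.2.2.1] using p.1.2
      | succ i => simpa only [← Fin.succ_castSucc, Fin.cons_succ] using p.2.2.2.2 i⟩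
  left_inv := by
    rintro ⟨w, rfl, h⟩
    exact Subtype.ext (Fin.cons_self_tail w)
  right_inv := by
    rintro ⟨⟨y, hy⟩, ⟨w, h0, h⟩⟩
    obtain rfl : w 0 = y := h0
    rfl

lemma walkCount_zero {S : Type*} (R : S → S → Prop) (s t : S) :
    walkCount R 0 s t = if s = t then 1 else 0 := by
  rw [walkCount]
  split_ifs with h
  · subst h
    rw [Nat.card_eq_one_iff_unique]
    refine ⟨⟨fun v w => Subtype.ext (funext fun i => ?_)⟩, ⟨⟨fun _ => s, rfl, rfl, fun i => i.elim0⟩⟩⟩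
    obtain rfl : i = 0 := Fin.fin_one_eq_zero i
    rw [v.2.1, w.2.1]
  · rw [Nat.card_eq_zero]
    exact Or.inl ⟨fun w => h (w.2.1.symm.trans w.2.2.1)⟩

lemma finite_walks {S : Type*} {R : S → S → Prop} (hR : ∀ s, Finite {y // R s y}) (n : ℕ)
    (s t : S) : Finite {w : Fin (n + 1) → S //
      w 0 = s ∧ w (Fin.last n) = t ∧ ∀ i : Fin n, R (w i.castSucc) (w i.succ)} := by
  induction n generalizing s with
  | zero =>
    refine @Finite.of_subsingleton _ ⟨fun v w => Subtype.ext (funext fun i => ?_)⟩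
    obtain rfl : i = 0 := Fin.fin_one_eq_zero i
    rw [v.2.1, w.2.1]
  | succ n ih =>
    have := fun y : {y // R s y} => ih y.1
    have := hR s
    exact Finite.of_equiv _ (walkSuccEquiv R n s t).symm

lemma walkCount_succ {S : Type*} {R : S → S → Prop} (hR : ∀ s, Finite {y // R s y}) (n : ℕ)
    (s t : S) {ι : Type*} [Fintype ι] (e : ι ≃ {y // R s y}) :
    walkCount R (n + 1) s t = ∑ i, walkCount R n (e i) t := by
  have := fun y : {y // R s y} => finite_walks hR n y.1 t
  have := Fintype.ofEquiv ι e
  rw [walkCount, Nat.card_congr (walkSuccEquiv R n s t), Nat.card_sigma]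
  exact (Equiv.sum_comp e fun y => walkCount R n y.1 t).symm

/-- Configurations of `ℓ` non-colliding particles on `ℕ`. -/
abbrev Config (ℓ : ℕ) : Type :=
  {x : Fin ℓ → ℤ // StrictMono x ∧ ∀ i, 0 ≤ x i}

/-- One particle hops to a neighbouring site, or the particle at `0` stays there. -/
def Config.Hop {ℓ : ℕ} (x y : Config ℓ) : Prop :=
  (∃ j, y.1 = Function.update x.1 j (x.1 j + 1)) ∨
    (∃ j, x.1 = Function.update y.1 j (y.1 j + 1)) ∨ (x = y ∧ ∃ i, x.1 i = 0)

/-- The configuration occupying the sites `0, …, ℓ - 1`. -/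
def Config.ground (ℓ : ℕ) : Config ℓ :=
  ⟨fun i => i, fun i j h => by simpa using h, fun i => by simp⟩

/-- The possible hops from `x`. -/
abbrev Config.HopIndex {ℓ : ℕ} (x : Config ℓ) : Type :=
  {j // StrictMono (Function.update x.1 j (x.1 j + 1)) ∧
      ∀ i, 0 ≤ Function.update x.1 j (x.1 j + 1) i} ⊕
    {j // StrictMono (Function.update x.1 j (x.1 j - 1)) ∧
      ∀ i, 0 ≤ Function.update x.1 j (x.1 j - 1) i} ⊕
    {_u : Unit // ∃ i, x.1 i = 0}

/-- The outcome of a hop from `x`. -/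
def Config.hopTarget {ℓ : ℕ} (x : Config ℓ) : x.HopIndex → Config ℓ :=
  Sum.elim (fun j => ⟨_, j.2⟩) (Sum.elim (fun j => ⟨_, j.2⟩) fun _ => x)

lemma Config.hopTarget_injective {ℓ : ℕ} (x : Config ℓ) : Function.Injective x.hopTarget := by
  have key : ∀ (i j : Fin ℓ) (a b : ℤ), a ≠ 0 →
      Function.update x.1 i (x.1 i + a) = Function.update x.1 j (x.1 j + b) → i = j ∧ a = b := by
    intro i j a b ha h
    have := congrFun h i
    rw [Function.update_self] at this
    rcases eq_or_ne i j with rfl | hij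
    · rw [Function.update_self] at this
      exact ⟨rfl, by omega⟩
    · rw [Function.update_of_ne hij] at this
      omega
  have hx : ∀ (i : Fin ℓ) (a : ℤ), a ≠ 0 → Function.update x.1 i (x.1 i + a) ≠ x.1 := by
    intro i a ha h
    have := congrFun h i
    rw [Function.update_self] at this
    omega
  rintro (⟨i, hi⟩ | ⟨i, hi⟩ | ⟨i, hi⟩) (⟨j, hj⟩ | ⟨j, hj⟩ | ⟨j, hj⟩) h
  all_goals replace h := congrArg Subtype.val h
  all_goals simp only [Config.hopTarget, Sum.elim_inl, Sum.elim_inr, sub_eq_add_neg] at h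
  · obtain ⟨rfl, -⟩ := key _ _ _ _ (by simp) h; rfl
  · obtain ⟨-, h⟩ := key _ _ _ _ (by simp) h; omega
  · exact absurd h (hx _ _ (by simp))
  · obtain ⟨-, h⟩ := key _ _ _ _ (by simp) h; omega
  · obtain ⟨rfl, -⟩ := key _ _ _ _ (by simp) h; rfl
  · exact absurd h (hx _ _ (by simp))
  · exact absurd h.symm (hx _ _ (by simp))
  · exact absurd h.symm (hx _ _ (by simp))
  · rfl

lemma Config.hop_iff {ℓ : ℕ} (x y : Config ℓ) : x.Hop y ↔ ∃ i, x.hopTarget i = y := by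
  constructor
  · rintro (⟨j, h⟩ | ⟨j, h⟩ | ⟨rfl, h⟩)
    · exact ⟨.inl ⟨j, h ▸ y.2⟩, Subtype.ext h.symm⟩
    · have h' : Function.update x.1 j (x.1 j - 1) = y.1 := by rw [h]; simp
      exact ⟨.inr (.inl ⟨j, h'.symm ▸ y.2⟩), Subtype.ext h'⟩
    · exact ⟨.inr (.inr ⟨(), h⟩), rfl⟩
  · rintro ⟨⟨j, hj⟩ | ⟨j, hj⟩ | ⟨-, h⟩, rfl⟩
    · exact .inl ⟨j, rfl⟩
    · exact .inr (.inl ⟨j, by simp [Config.hopTarget]⟩)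
    · exact .inr (.inr ⟨rfl, h⟩)

/-- Hops from `x` are indexed by `x.HopIndex`. -/
def Config.hopEquiv {ℓ : ℕ} (x : Config ℓ) : x.HopIndex ≃ {y // x.Hop y} :=
  Equiv.ofBijective (fun i => ⟨x.hopTarget i, (x.hop_iff _).2 ⟨i, rfl⟩⟩)
    ⟨fun _ _ h => x.hopTarget_injective (congrArg Subtype.val h), fun y => by
      obtain ⟨i, hi⟩ := (x.hop_iff _).1 y.2
      exact ⟨i, Subtype.ext hi⟩⟩

lemma slaterDet_update_eq_zero {ℓ : ℕ} {x : Fin ℓ → ℤ} (hx : StrictMono x) (j : Fin ℓ) {a : ℤ}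
    (ha : |a - x j| ≤ 1) (h : ¬ StrictMono (Function.update x j a)) :
    slaterDet (Function.update x j a) = 0 := by
  by_contra h0
  have hinj : Function.Injective (Function.update x j a) := fun p q hpq => by
    by_contra hne
    exact h0 (slaterDet_eq_zero hne hpq)
  rw [abs_le] at ha
  refine h fun p q hpq => lt_of_le_of_ne ?_ (hinj.ne hpq.ne)
  have hlt := hx hpq
  rcases eq_or_ne p j with rfl | hp
  · rw [Function.update_self, Function.update_of_ne hpq.ne']; omega
  · rw [Function.update_of_ne hp]
    rcases eq_or_ne q j with rfl | hq
    · rw [Function.update_self]; omega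
    · rw [Function.update_of_ne hq]; omega

lemma sum_slaterDet_hopTarget {ℓ : ℕ} (x : Config ℓ) :
    ∑ i, slaterDet (x.hopTarget i).1 = PowerSeries.derivative ℚ (slaterDet x.1) := by
  obtain ⟨x, hx, h0⟩ := x
  rw [derivative_slaterDet, Finset.sum_add_distrib]
  have hsum : ∀ (p : Fin ℓ → Prop) (_ : Fintype {j // p j}) (f : Fin ℓ → PowerSeries ℚ),
      ∑ j : {j // p j}, f j = ∑ j, if p j then f j else 0 := fun p _ f => by
    rw [← Finset.sum_filter]
    exact (Finset.sum_subtype _ (by simp) f).symm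
  rw [Fintype.sum_sum_type, Fintype.sum_sum_type]
  simp only [Config.hopTarget, Sum.elim_inl, Sum.elim_inr]
  rw [hsum (fun j => StrictMono (Function.update x j (x j + 1)) ∧ _) _
      (fun j => slaterDet (Function.update x j (x j + 1))),
    hsum (fun j => StrictMono (Function.update x j (x j - 1)) ∧ _) _
      (fun j => slaterDet (Function.update x j (x j - 1)))]
  congr 1
  · refine Finset.sum_congr rfl fun j _ => ?_
    split_ifs with h
    · rfl
    · refine (slaterDet_update_eq_zero hx j (by simp) fun hm => h ⟨hm, fun i => ?_⟩).symm
      have := h0 i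
      rcases eq_or_ne i j with rfl | hij
      · rw [Function.update_self]; change 0 ≤ x i + 1; omega
      · rwa [Function.update_of_ne hij]
  · have hstay : ∑ _u : {_u : Unit // ∃ i, x i = 0}, slaterDet x =
        ∑ j, if x j = 0 then slaterDet x else 0 := by
      by_cases h : ∃ i, x i = 0
      · obtain ⟨i, hi⟩ := h
        rw [Finset.sum_eq_single i (fun j _ hj => if_neg fun h => hj (hx.injective (h.trans hi.symm)))
          (by simp), if_pos hi]
        have : Unique {_u : Unit // ∃ i, x i = 0} := ⟨⟨⟨(), i, hi⟩⟩, fun _ => rfl⟩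
        rw [Fintype.sum_unique]
      · have : IsEmpty {_u : Unit // ∃ i, x i = 0} := ⟨fun u => h u.2⟩
        push Not at h
        simp [h]
    rw [hstay, ← Finset.sum_add_distrib]
    refine Finset.sum_congr rfl fun j _ => ?_
    by_cases hj : x j = 0
    · rw [if_pos hj, if_neg fun h => ?_, zero_add, hj, zero_sub, slaterDet_update_neg_one, ← hj,
        Function.update_eq_self]
      have h1 : 0 ≤ Function.update x j (x j - 1) j := h.2 j
      rw [Function.update_self] at h1
      omega
    · rw [if_neg hj, add_zero]
      split_ifs with h
      · rfl
      · refine (slaterDet_update_eq_zero hx j (by simp) fun hm => h ⟨hm, fun i => ?_⟩).symm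
        have := h0 i
        rcases eq_or_ne i j with rfl | hij
        · rw [Function.update_self]; change 0 ≤ x i - 1; omega
        · rwa [Function.update_of_ne hij]

theorem walkCount_hop {ℓ : ℕ} (n : ℕ) (x : Config ℓ) :
    (walkCount Config.Hop n x (Config.ground ℓ) : ℚ) =
      n.factorial * PowerSeries.coeff n (slaterDet x.1) := by
  have hfin : ∀ x : Config ℓ, Finite {y // x.Hop y} := fun x => Finite.of_equiv _ x.hopEquiv
  induction n generalizing x with
  | zero =>
    rw [walkCount_zero, PowerSeries.coeff_zero_eq_constantCoeff_apply,
      constantCoeff_slaterDet x.2.1 x.2.2]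
    simp [Subtype.ext_iff, funext_iff, Config.ground]
  | succ n ih =>
    rw [walkCount_succ hfin n x _ x.hopEquiv, Nat.cast_sum]
    simp_rw [ih]
    rw [← Finset.mul_sum, ← map_sum]
    refine (congrArg (fun f => (n.factorial : ℚ) * PowerSeries.coeff n f)
      (sum_slaterDet_hopTarget x)).trans ?_
    rw [PowerSeries.coeff_derivative, Nat.factorial_succ]
    push_cast
    ring

/-- Partitions with at most `ℓ` columns, as weakly decreasing sequences of row lengths. -/
abbrev BddShape (ℓ : ℕ) : Type :=
  {f : ℕ → ℕ // Antitone f ∧ (∃ N, f N = 0) ∧ f 0 ≤ ℓ}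

/-- The empty partition. -/
def BddShape.empty (ℓ : ℕ) : BddShape ℓ :=
  ⟨fun _ => 0, antitone_const, ⟨0, rfl⟩, Nat.zero_le ℓ⟩

/-- Adding a box, removing a box, or staying at a partition with fewer than `ℓ` columns. -/
def BddShape.Step {ℓ : ℕ} (f g : BddShape ℓ) : Prop :=
  (∃ i, g.1 = Function.update f.1 i (f.1 i + 1)) ∨
    (∃ i, f.1 = Function.update g.1 i (g.1 i + 1)) ∨ (f = g ∧ f.1 0 < ℓ)

namespace BddShape

variable {ℓ : ℕ}

lemma le_bound (f : BddShape ℓ) (i : ℕ) : f.1 i ≤ ℓ :=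
  (f.2.1 (Nat.zero_le i)).trans f.2.2.2

lemma exists_row_add_lt (f : BddShape ℓ) (j : Fin ℓ) : ∃ i, f.1 i + j < ℓ := by
  obtain ⟨N, hN⟩ := f.2.2.1
  exact ⟨N, by have := j.2; omega⟩

/-- The height of the `j`-th column, counted from the right. -/
def colHeight (f : BddShape ℓ) (j : Fin ℓ) : ℕ :=
  Nat.find (f.exists_row_add_lt j)

lemma lt_colHeight_iff (f : BddShape ℓ) (j : Fin ℓ) (i : ℕ) :
    i < f.colHeight j ↔ ℓ ≤ f.1 i + j := by
  rw [colHeight, Nat.lt_find_iff]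
  refine ⟨fun h => not_lt.1 (h i le_rfl), fun h m hm => not_lt.2 (h.trans ?_)⟩
  exact Nat.add_le_add_right (f.2.1 hm) _

lemma colHeight_eq {f : BddShape ℓ} {j : Fin ℓ} {n : ℕ} (h : ∀ i, i < n ↔ ℓ ≤ f.1 i + j) :
    f.colHeight j = n :=
  eq_of_forall_lt_iff fun i => (f.lt_colHeight_iff j i).trans (h i).symm

/-- The particle configuration recorded by the columns of a partition. -/
def toConfig (f : BddShape ℓ) : Config ℓ :=
  ⟨fun j => j + f.colHeight j, fun i j hij => by
    have h : f.colHeight i ≤ f.colHeight j := by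
      refine le_of_forall_lt fun k hk => ?_
      rw [lt_colHeight_iff] at hk ⊢
      have : (i : ℕ) < j := hij
      omega
    have : (i : ℕ) < j := hij
    push_cast
    omega, fun i => by positivity⟩

lemma row_eq {f g : BddShape ℓ} {i : ℕ} (h : ∀ j : Fin ℓ, ℓ ≤ f.1 i + j ↔ ℓ ≤ g.1 i + j) :
    f.1 i = g.1 i := by
  have h1 := f.le_bound i
  have h2 := g.le_bound i
  rcases lt_trichotomy (f.1 i) (g.1 i) with hlt | heq | hlt
  · have := h ⟨ℓ - g.1 i, by omega⟩
    simp only at this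
    omega
  · exact heq
  · have := h ⟨ℓ - f.1 i, by omega⟩
    simp only at this
    omega

lemma toConfig_injective : Function.Injective (toConfig (ℓ := ℓ)) := by
  intro f g h
  refine Subtype.ext (funext fun i => row_eq fun j => ?_)
  have := congrFun (congrArg Subtype.val h) j
  simp only [toConfig] at this
  rw [← lt_colHeight_iff, ← lt_colHeight_iff, show f.colHeight j = g.colHeight j by omega]

end BddShape

lemma Config.add_le {ℓ : ℕ} (x : Config ℓ) {i j : Fin ℓ} (h : i ≤ j) :
    x.1 i + j ≤ x.1 j + i := by
  obtain ⟨j, hj⟩ := j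
  obtain ⟨k, rfl⟩ := Nat.exists_eq_add_of_le (show (i : ℕ) ≤ j from h)
  induction k with
  | zero => simp
  | succ k ih =>
    have h1 := ih (by omega) (by simp [Fin.le_def])
    have h2 := x.2.1 (show (⟨i + k, by omega⟩ : Fin ℓ) < ⟨i + (k + 1), hj⟩ by simp [Fin.lt_def])
    push_cast at h1 ⊢
    omega

namespace BddShape

variable {ℓ : ℕ}

lemma toConfig_surjective : Function.Surjective (toConfig (ℓ := ℓ)) := by
  intro x
  have hex : ∀ i : ℕ, ∃ j, ∀ h : j < ℓ, (i : ℤ) + j < x.1 ⟨j, h⟩ :=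
    fun i => ⟨ℓ, fun h => absurd h (lt_irrefl _)⟩
  have hle : ∀ (i : ℕ) (j : Fin ℓ), Nat.find (hex i) ≤ j ↔ (i : ℤ) + j < x.1 j := by
    intro i j
    rw [Nat.find_le_iff]
    constructor
    · rintro ⟨m, hm, h⟩
      have h1 := h (hm.trans_lt j.2)
      have h2 := x.add_le (show (⟨m, hm.trans_lt j.2⟩ : Fin ℓ) ≤ j from hm)
      simp only at h2
      omega
    · exact fun h => ⟨j, le_rfl, fun _ => h⟩
  have hfind : ∀ i, Nat.find (hex i) ≤ ℓ :=
    fun i => Nat.find_min' _ fun h => absurd h (lt_irrefl _)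
  let f : BddShape ℓ := ⟨fun i => ℓ - Nat.find (hex i), ?_, ?_, Nat.sub_le _ _⟩
  · refine ⟨f, Subtype.ext (funext fun j => ?_)⟩
    have h0 := x.add_le (show (⟨0, j.pos⟩ : Fin ℓ) ≤ j from Nat.zero_le _)
    have h1 := x.2.2 ⟨0, j.pos⟩
    change x.1 ⟨0, j.pos⟩ + (j : ℤ) ≤ x.1 j + ((0 : ℕ) : ℤ) at h0
    have : f.colHeight j = (x.1 j - j).toNat := colHeight_eq fun i => by
      have h2 := hle i j
      have h3 := hfind i
      have : ℓ ≤ f.1 i + j ↔ Nat.find (hex i) ≤ j := by simp only [f]; omega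
      rw [this, h2]
      omega
    change (j : ℤ) + (f.colHeight j : ℤ) = x.1 j
    rw [this]
    omega
  · intro i i' hi
    refine Nat.sub_le_sub_left (Nat.find_mono fun j h hj => ?_) ℓ
    have := h hj
    have : (i : ℤ) ≤ i' := by exact_mod_cast hi
    omega
  · refine ⟨Finset.univ.sup fun j => (x.1 j).toNat, Nat.sub_eq_zero_of_le ?_⟩
    rw [Nat.le_find_iff]
    intro j hj h
    have h1 := h hj
    have h2 : (x.1 ⟨j, hj⟩).toNat ≤ Finset.univ.sup fun j => (x.1 j).toNat :=
      Finset.le_sup (f := fun j => (x.1 j).toNat) (Finset.mem_univ _)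
    omega

lemma exists_eq_update_iff (f g : BddShape ℓ) :
    (∃ i, g.1 = Function.update f.1 i (f.1 i + 1)) ↔
      ∃ j, g.toConfig.1 = Function.update f.toConfig.1 j (f.toConfig.1 j + 1) := by
  constructor
  · rintro ⟨i, h⟩
    have hi : g.1 i = f.1 i + 1 := by rw [h, Function.update_self]
    have hk : ∀ k, k ≠ i → g.1 k = f.1 k := fun k hk => by rw [h, Function.update_of_ne hk]
    have hb := g.le_bound i
    refine ⟨⟨ℓ - 1 - f.1 i, by omega⟩, funext fun j => ?_⟩
    rcases eq_or_ne j ⟨ℓ - 1 - f.1 i, by omega⟩ with rfl | hj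
    · have hf : f.colHeight ⟨ℓ - 1 - f.1 i, by omega⟩ = i := colHeight_eq fun k => by
        rcases lt_or_ge k i with hki | hki
        · have h1 := g.2.1 hki.le
          have h2 := hk k hki.ne
          simp only; omega
        · have h1 := f.2.1 hki
          simp only; omega
      have hg : g.colHeight ⟨ℓ - 1 - f.1 i, by omega⟩ = i + 1 := colHeight_eq fun k => by
        rcases le_or_gt k i with hki | hki
        · have h1 := g.2.1 hki
          simp only; omega
        · have h1 := f.2.1 hki.le
          have h2 := hk k hki.ne'
          simp only; omega
      rw [Function.update_self]
      simp only [toConfig, hf, hg]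
      push_cast
      ring
    · rw [Function.update_of_ne hj]
      have : g.colHeight j = f.colHeight j := colHeight_eq fun k => by
        rw [lt_colHeight_iff]
        rcases eq_or_ne k i with rfl | hki
        · have : (j : ℕ) ≠ ℓ - 1 - f.1 k := fun h => hj (Fin.ext h)
          omega
        · rw [hk k hki]
      simp only [toConfig, this]
  · rintro ⟨j, h⟩
    have hj : g.colHeight j = f.colHeight j + 1 := by
      have := congrFun h j
      rw [Function.update_self] at this
      simp only [toConfig] at this
      omega
    have hj' : ∀ j', j' ≠ j → g.colHeight j' = f.colHeight j' := fun j' hne => by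
      have := congrFun h j'
      rw [Function.update_of_ne hne] at this
      simp only [toConfig] at this
      omega
    have hcell : ∀ i j', j' ≠ j → (ℓ ≤ g.1 i + j' ↔ ℓ ≤ f.1 i + j') := fun i j' hne => by
      rw [← lt_colHeight_iff, ← lt_colHeight_iff, hj' j' hne]
    refine ⟨f.colHeight j, funext fun i => ?_⟩
    have hi := f.lt_colHeight_iff j i
    have hi' := g.lt_colHeight_iff j i
    have hjl := j.2
    rcases eq_or_ne i (f.colHeight j) with rfl | hne
    · rw [Function.update_self]
      have hb := g.le_bound (f.colHeight j)
      have h1 : ℓ ≤ f.1 (f.colHeight j) + (j + 1) := by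
        by_cases hl : (j : ℕ) + 1 < ℓ
        · have := hcell (f.colHeight j) ⟨j + 1, hl⟩ (by simp [Fin.ext_iff])
          simp only at this
          omega
        · omega
      by_contra hne
      have := hcell (f.colHeight j) ⟨j - 1, by omega⟩ (by simp only [ne_eq, Fin.ext_iff]; omega)
      simp only at this
      omega
    · rw [Function.update_of_ne hne]
      refine row_eq fun j' => ?_
      rcases eq_or_ne j' j with rfl | hne'
      · omega
      · exact hcell i j' hne'

lemma step_iff_hop (hl : 1 ≤ ℓ) (f g : BddShape ℓ) : f.Step g ↔ f.toConfig.Hop g.toConfig := by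
  rw [Step, Config.Hop, exists_eq_update_iff, exists_eq_update_iff, toConfig_injective.eq_iff]
  refine or_congr Iff.rfl (or_congr Iff.rfl (and_congr_right fun _ => ?_))
  have h := f.lt_colHeight_iff ⟨0, hl⟩ 0
  simp only [add_zero] at h
  constructor
  · intro hlt
    refine ⟨⟨0, hl⟩, ?_⟩
    simp only [toConfig]
    omega
  · rintro ⟨i, hi⟩
    have : i = ⟨0, hl⟩ := Fin.ext (by simp only [toConfig] at hi; simp only; omega)
    subst this
    simp only [toConfig] at hi
    omega

lemma toConfig_empty : (empty ℓ).toConfig = Config.ground ℓ := by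
  refine Subtype.ext (funext fun j => ?_)
  have : (empty ℓ).colHeight j = 0 := colHeight_eq fun i => by
    have := j.2
    simp only [empty]
    omega
  simp [toConfig, Config.ground, this]

end BddShape

/-- Closed walks of partitions are counted by a determinant of Bessel series. -/
theorem walkCount_step {ℓ : ℕ} (hl : 1 ≤ ℓ) (n : ℕ) :
    (walkCount BddShape.Step n (BddShape.empty ℓ) (BddShape.empty ℓ) : ℚ) =
      n.factorial * PowerSeries.coeff n (slaterDet fun i : Fin ℓ => (i : ℤ)) := by
  have h := walkCount_congr (Equiv.ofBijective BddShape.toConfig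
    ⟨BddShape.toConfig_injective, BddShape.toConfig_surjective⟩)
    (fun f g => BddShape.step_iff_hop hl f g) n (BddShape.empty ℓ) (BddShape.empty ℓ)
  rw [h]
  change (walkCount Config.Hop n (BddShape.toConfig _) (BddShape.toConfig _) : ℚ) = _
  rw [BddShape.toConfig_empty]
  exact walkCount_hop n _

/-- `g` is obtained from the partition `f` by adding a horizontal strip. -/
def Interlace (f g : ℕ → ℕ) : Prop :=
  ∀ i, f i ≤ g i ∧ g (i + 1) ≤ f i

/-- The local rule of Robinson–Schensted growth diagrams. -/
def localRule (x : ℕ) (k f g : ℕ → ℕ) : ℕ → ℕ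
  | 0 => max (f 0) (g 0) + x
  | i + 1 => max (f (i + 1)) (g (i + 1)) + min (f i) (g i) - k i

/-- The inverse of the local rule. -/
def backRule (f g h : ℕ → ℕ) (i : ℕ) : ℕ :=
  max (f (i + 1)) (g (i + 1)) + min (f i) (g i) - h (i + 1)

lemma localRule_comm (x : ℕ) (k f g : ℕ → ℕ) : localRule x k f g = localRule x k g f := by
  funext i
  cases i <;> simp only [localRule, max_comm, min_comm]

lemma Interlace.localRule {k f g : ℕ → ℕ} (hf : Interlace k f) (hg : Interlace k g) (x : ℕ) :
    Interlace f (localRule x k f g) := by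
  rintro (_ | i)
  · have := hf 0; have := hg 0
    simp only [_root_.localRule]
    omega
  · have := hf i; have := hg i; have := hf (i + 1); have := hg (i + 1)
    simp only [_root_.localRule]
    omega

lemma Interlace.backRule {f g h : ℕ → ℕ} (hf : Interlace f h) (hg : Interlace g h) :
    Interlace (backRule f g h) f ∧ Interlace (backRule f g h) g := by
  constructor <;>
  · intro i
    have := hf i; have := hg i; have := hf (i + 1); have := hg (i + 1)
    simp only [_root_.backRule]
    omega

lemma backRule_localRule {k f g : ℕ → ℕ} (hf : Interlace k f) (hg : Interlace k g) (x : ℕ) :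
    backRule f g (localRule x k f g) = k := by
  funext i
  have := hf i; have := hg i
  simp only [backRule, localRule]
  omega

lemma localRule_backRule {f g h : ℕ → ℕ} (hf : Interlace f h) (hg : Interlace g h) :
    localRule (h 0 - max (f 0) (g 0)) (backRule f g h) f g = h := by
  funext i
  cases i with
  | zero =>
    have := hf 0; have := hg 0
    simp only [localRule]
    omega
  | succ i =>
    have := hf i; have := hg i; have := hf (i + 1); have := hg (i + 1)
    simp only [backRule, localRule]
    omega

lemma sum_localRule {k f g : ℕ → ℕ} (hf : Interlace k f) (hg : Interlace k g) (x N : ℕ) :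
    ∑ i ∈ Finset.range (N + 1), localRule x k f g i + ∑ i ∈ Finset.range N, k i =
      ∑ i ∈ Finset.range N, f i + ∑ i ∈ Finset.range N, g i + max (f N) (g N) + x := by
  induction N with
  | zero => simp [localRule]
  | succ N ih =>
    rw [Finset.sum_range_succ, Finset.sum_range_succ k, Finset.sum_range_succ f,
      Finset.sum_range_succ g]
    have := hf N; have := hg N
    simp only [localRule] at ih ⊢
    omega

/-- The growth diagram of the matrix `X`. -/
def growth (X : ℕ → ℕ → ℕ) : ℕ → ℕ → ℕ → ℕ
  | 0, _ => 0
  | _ + 1, 0 => 0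
  | a + 1, c + 1 => localRule (X a c) (growth X a c) (growth X (a + 1) c) (growth X a (c + 1))

section growth

variable (X : ℕ → ℕ → ℕ)

@[simp] lemma growth_zero_left (c : ℕ) : growth X 0 c = 0 := by rw [growth]

@[simp] lemma growth_zero_right (a : ℕ) : growth X a 0 = 0 := by cases a <;> rw [growth]

lemma growth_succ_succ (a c : ℕ) : growth X (a + 1) (c + 1) =
    localRule (X a c) (growth X a c) (growth X (a + 1) c) (growth X a (c + 1)) := by
  rw [growth]

lemma interlace_growth (a c : ℕ) : Interlace (growth X a c) (growth X (a + 1) c) ∧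
    Interlace (growth X a c) (growth X a (c + 1)) := by
  have h0 : Interlace 0 0 := fun _ => ⟨le_rfl, le_rfl⟩
  induction a generalizing c with
  | zero =>
    induction c with
    | zero => simpa using h0
    | succ c ih =>
      refine ⟨?_, by simpa using h0⟩
      rw [growth_succ_succ, localRule_comm]
      exact ih.2.localRule ih.1 _
  | succ a iha =>
    have hcol : ∀ c, Interlace (growth X (a + 1) c) (growth X (a + 1) (c + 1)) := fun c => by
      rw [growth_succ_succ]
      exact (iha c).1.localRule (iha c).2 _
    refine ⟨?_, hcol c⟩
    induction c with
    | zero => simpa using h0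
    | succ c ih =>
      rw [growth_succ_succ X (a + 1), localRule_comm]
      exact (hcol c).localRule ih _

lemma growth_mono_left {a a' : ℕ} (h : a ≤ a') (c i : ℕ) : growth X a c i ≤ growth X a' c i :=
  monotone_nat_of_le_succ (f := fun a => growth X a c i)
    (fun a => ((interlace_growth X a c).1 i).1) h

lemma growth_mono_right (a : ℕ) {c c' : ℕ} (h : c ≤ c') (i : ℕ) :
    growth X a c i ≤ growth X a c' i :=
  monotone_nat_of_le_succ (f := fun c => growth X a c i)
    (fun c => ((interlace_growth X a c).2 i).1) h

lemma antitone_growth (a c : ℕ) : Antitone (growth X a c) :=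
  antitone_nat_of_succ_le fun i =>
    (((interlace_growth X a c).1 (i + 1)).1).trans ((interlace_growth X a c).1 i).2

lemma growth_eq_zero {a i : ℕ} (h : a ≤ i) (c : ℕ) : growth X a c i = 0 := by
  induction a generalizing i c with
  | zero => simp
  | succ a ih =>
    have := ((interlace_growth X a c).1 (i - 1)).2
    rw [ih (by omega), Nat.sub_add_cancel (by omega)] at this
    omega

/-- The number of boxes of a partition with at most `K` rows. -/
def boxes (K : ℕ) (f : ℕ → ℕ) : ℕ :=
  ∑ i ∈ Finset.range K, f i

lemma boxes_growth_succ_succ {K a : ℕ} (h : a + 1 ≤ K) (c : ℕ) :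
    boxes K (growth X (a + 1) (c + 1)) + boxes K (growth X a c) =
      boxes K (growth X (a + 1) c) + boxes K (growth X a (c + 1)) + X a c := by
  have := sum_localRule (interlace_growth X a c).1 (interlace_growth X a c).2 (X a c) K
  rw [← growth_succ_succ, Finset.sum_range_succ, growth_eq_zero X h, growth_eq_zero X h,
    growth_eq_zero X (by omega)] at this
  simpa [boxes] using this

lemma boxes_growth_succ_left {K a : ℕ} (h : a + 1 ≤ K) (c : ℕ) :
    boxes K (growth X (a + 1) c) = boxes K (growth X a c) + ∑ j ∈ Finset.range c, X a j := by
  induction c with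
  | zero => simp
  | succ c ih =>
    have := boxes_growth_succ_succ X h c
    rw [Finset.sum_range_succ]
    omega

lemma boxes_growth_succ_right {K a : ℕ} (h : a ≤ K) (c : ℕ) :
    boxes K (growth X a (c + 1)) = boxes K (growth X a c) + ∑ j ∈ Finset.range a, X j c := by
  induction a with
  | zero => simp
  | succ a ih =>
    have := boxes_growth_succ_succ X h c
    rw [Finset.sum_range_succ]
    have := ih (by omega)
    omega

end growth

lemma Interlace.eq_of_boxes_eq {f g : ℕ → ℕ} (h : Interlace f g) {K : ℕ}
    (hg : ∀ i, K ≤ i → g i = 0) (hb : boxes K g = boxes K f) : g = f := by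
  funext i
  rcases le_or_gt K i with hi | hi
  · have := (h i).1
    have := hg i hi
    omega
  · exact ((Finset.sum_eq_sum_iff_of_le fun i _ => (h i).1).1 hb.symm i (Finset.mem_range.2 hi)).symm

lemma Interlace.exists_eq_update {f g : ℕ → ℕ} (h : Interlace f g) {K : ℕ}
    (hg : ∀ i, K ≤ i → g i = 0) (hb : boxes K g = boxes K f + 1) :
    ∃ i, g = Function.update f i (f i + 1) := by
  obtain ⟨i, hi, hlt⟩ : ∃ i ∈ Finset.range K, f i < g i := by
    by_contra! hle
    have := Finset.sum_le_sum hle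
    simp only [boxes] at hb
    omega
  have hle : ∀ j, Function.update f i (f i + 1) j ≤ g j := fun j => by
    rcases eq_or_ne j i with rfl | hj
    · rw [Function.update_self]; omega
    · rw [Function.update_of_ne hj]; exact (h j).1
  have hsum : boxes K (Function.update f i (f i + 1)) = boxes K f + 1 := by
    rw [boxes, boxes, Finset.sum_update_of_mem hi, Finset.sdiff_singleton_eq_erase,
      ← Finset.add_sum_erase _ f hi]
    ring
  refine ⟨i, funext fun j => ?_⟩
  rcases le_or_gt K j with hj | hj
  · have := hle j
    have := hg j hj
    omega
  · exact ((Finset.sum_eq_sum_iff_of_le fun j _ => hle j).1 (hsum.trans hb.symm) j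
      (Finset.mem_range.2 hj)).symm

/-- `X` has `k` nonzero entries in rows `< a` and columns `< c`, with increasing rows and
columns. -/
def HasChain (X : ℕ → ℕ → ℕ) : ℕ → ℕ → ℕ → Prop
  | 0, _, _ => True
  | k + 1, a, c => ∃ a' < a, ∃ c' < c, X a' c' ≠ 0 ∧ HasChain X k a' c'

lemma HasChain.mono {X : ℕ → ℕ → ℕ} {k a c a' c' : ℕ} (h : HasChain X k a c) (ha : a ≤ a')
    (hc : c ≤ c') : HasChain X k a' c' := by
  cases k with
  | zero => trivial
  | succ k =>
    obtain ⟨p, hp, q, hq, h⟩ := h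
    exact ⟨p, hp.trans_le ha, q, hq.trans_le hc, h⟩

lemma HasChain.le_growth {X : ℕ → ℕ → ℕ} {k a c : ℕ} (h : HasChain X k a c) :
    k ≤ growth X a c 0 := by
  induction k generalizing a c with
  | zero => exact Nat.zero_le _
  | succ k ih =>
    obtain ⟨p, hp, q, hq, hX, h⟩ := h
    have h1 := ih h
    have h2 := growth_mono_left X (show p + 1 ≤ a from hp) c 0
    have h3 := growth_mono_right X (p + 1) (show q + 1 ≤ c from hq) 0
    have h4 := growth_mono_right X p (Nat.le_add_right q 1) 0
    rw [growth_succ_succ, localRule] at h3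
    omega

lemma hasChain_of_le_growth {X : ℕ → ℕ → ℕ} (h1 : ∀ a c, X a c ≤ 1)
    (hrow : ∀ a c c', X a c ≠ 0 → X a c' ≠ 0 → c = c')
    (hcol : ∀ a a' c, X a c ≠ 0 → X a' c ≠ 0 → a = a') {k a c : ℕ}
    (h : k ≤ growth X a c 0) : HasChain X k a c := by
  induction a generalizing k c with
  | zero =>
    obtain rfl : k = 0 := by simpa using h
    trivial
  | succ a iha =>
    induction c generalizing k with
    | zero =>
      obtain rfl : k = 0 := by simpa using h
      trivial
    | succ c ihc =>
      rw [growth_succ_succ, localRule] at h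
      by_cases hX : X a c = 0
      · rw [hX, add_zero, le_max_iff] at h
        exact h.elim (fun h => (ihc h).mono le_rfl (Nat.le_succ c))
          (fun h => (iha h).mono (Nat.le_succ a) le_rfl)
      · cases k with
        | zero => trivial
        | succ k =>
          refine ⟨a, Nat.lt_succ_self a, c, Nat.lt_succ_self c, hX, ?_⟩
          have hk : k ≤ max (growth X (a + 1) c 0) (growth X a (c + 1) 0) := by
            have := h1 a c
            omega
          cases k with
          | zero => trivial
          | succ k =>
            rcases le_max_iff.1 hk with h | h
            · obtain ⟨p, hp, q, hq, hX', h⟩ := ihc h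
              refine ⟨p, lt_of_le_of_ne (Nat.lt_succ_iff.1 hp) ?_, q, hq, hX', h⟩
              rintro rfl
              exact hq.ne (hrow _ _ _ hX' hX)
            · obtain ⟨p, hp, q, hq, hX', h⟩ := iha h
              refine ⟨p, hp, q, lt_of_le_of_ne (Nat.lt_succ_iff.1 hq) ?_, hX', h⟩
              rintro rfl
              exact hp.ne (hcol _ _ _ hX' hX)

lemma min_growth {X : ℕ → ℕ → ℕ} {a c : ℕ}
    (h : ∑ j ∈ Finset.range c, X a j + ∑ j ∈ Finset.range a, X j c ≤ 1) (i : ℕ) :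
    growth X a c i = min (growth X a (c + 1) i) (growth X (a + 1) c i) := by
  have h1 := interlace_growth X a c
  have hl := boxes_growth_succ_left X (le_refl (a + 1)) c
  have hr := boxes_growth_succ_right X (le_refl a) c
  rcases (show (∑ j ∈ Finset.range c, X a j = 0) ∨ ∑ j ∈ Finset.range a, X j c = 0 by omega)
    with h0 | h0
  · rw [h1.1.eq_of_boxes_eq (fun i hi => growth_eq_zero X hi c) (by rw [hl, h0]; rfl)]
    exact (min_eq_right (h1.2 i).1).symm
  · rw [h1.2.eq_of_boxes_eq (fun i hi => growth_eq_zero X hi (c + 1)) (by rw [hr, h0]; rfl)]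
    exact (min_eq_left (h1.1 i).1).symm

/-- Two partitions are equal or differ by one box. -/
def NearShape (f g : ℕ → ℕ) : Prop :=
  (∃ i, g = Function.update f i (f i + 1)) ∨ (∃ i, f = Function.update g i (g i + 1)) ∨ f = g

lemma NearShape.interlace {f g : ℕ → ℕ} (h : NearShape f g) (hf : Antitone f) (hg : Antitone g) :
    Interlace (fun i => min (f i) (g i)) f ∧ Interlace (fun i => min (f i) (g i)) g := by
  have key : ∀ {f g : ℕ → ℕ}, (∃ i, g = Function.update f i (f i + 1)) → Antitone f →
      Antitone g → Interlace (fun i => min (f i) (g i)) f ∧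
        Interlace (fun i => min (f i) (g i)) g := by
    rintro f g ⟨i, rfl⟩ hf hg
    constructor <;> intro j <;> have h1 := hf (Nat.le_add_right j 1) <;>
      have h2 := hg (Nat.le_add_right j 1) <;> simp only [Function.update_apply] at h2 ⊢ <;>
      split_ifs at h2 ⊢ <;> omega
  rcases h with h | h | rfl
  · exact key h hf hg
  · have := key h hg hf
    simp only [min_comm] at this ⊢
    exact this.symm
  · simp only [min_self]
    exact ⟨fun j => ⟨le_rfl, hf (Nat.le_add_right j 1)⟩, fun j => ⟨le_rfl, hf (Nat.le_add_right j 1)⟩⟩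

lemma NearShape.boxes {f g : ℕ → ℕ} (h : NearShape f g) (K : ℕ) :
    boxes K f + boxes K g ≤ 2 * boxes K (fun i => min (f i) (g i)) + 1 := by
  have key : ∀ {f g : ℕ → ℕ}, (∃ i, g = Function.update f i (f i + 1)) →
      _root_.boxes K f + _root_.boxes K g ≤ 2 * _root_.boxes K (fun i => min (f i) (g i)) + 1 := by
    rintro f g ⟨i, rfl⟩
    have h1 : (fun j => min (f j) (Function.update f i (f i + 1) j)) = f := by
      funext j
      rw [Function.update_apply]
      split_ifs with h
      · subst h; simp
      · simp
    have h2 : _root_.boxes K (Function.update f i (f i + 1)) ≤ _root_.boxes K f + 1 := by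
      by_cases hi : i ∈ Finset.range K
      · rw [_root_.boxes, _root_.boxes, Finset.sum_update_of_mem hi,
          Finset.sdiff_singleton_eq_erase, ← Finset.add_sum_erase _ f hi]
        omega
      · rw [_root_.boxes, _root_.boxes, Finset.sum_update_of_notMem hi]
        omega
    rw [h1]
    omega
  rcases h with h | h | rfl
  · exact key h
  · have := key h
    simp only [min_comm] at this ⊢
    omega
  · rw [show (fun i => min (f i) (f i)) = f from funext fun i => min_self _]
    omega

/-- The growth diagram reconstructed from its outer boundary `u`; `shrink u d a` lives at
distance `d` from the boundary. -/
def shrink (u : ℕ → ℕ → ℕ) : ℕ → ℕ → ℕ → ℕ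
  | 0, a => u a
  | 1, a => fun i => min (u a i) (u (a + 1) i)
  | d + 2, a => backRule (shrink u (d + 1) (a + 1)) (shrink u (d + 1) a) (shrink u d (a + 1))

lemma growth_eq_shrink {X u : ℕ → ℕ → ℕ} {n : ℕ} (hu : ∀ a ≤ n, growth X a (n - a) = u a)
    (hX : ∀ a < n, ∑ j ∈ Finset.range (n - 1 - a), X a j +
      ∑ j ∈ Finset.range a, X j (n - 1 - a) ≤ 1) (d : ℕ) :
    ∀ a c, a + c + d = n → growth X a c = shrink u d a := by
  induction d using Nat.strong_induction_on with
  | _ d ih =>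
    intro a c h
    match d, ih, h with
    | 0, _, h =>
      rw [shrink, ← hu a (by omega), show n - a = c by omega]
    | 1, _, h =>
      have h1 := hX a (by omega)
      rw [show n - 1 - a = c by omega] at h1
      funext i
      rw [shrink, min_growth h1, ← hu a (by omega), ← hu (a + 1) (by omega),
        show n - a = c + 1 by omega, show n - (a + 1) = c by omega]
    | d + 2, ih, h =>
      rw [shrink, ← ih (d + 1) (by omega) (a + 1) c (by omega),
        ← ih (d + 1) (by omega) a (c + 1) (by omega), ← ih d (by omega) (a + 1) (c + 1) (by omega),
        growth_succ_succ, backRule_localRule (interlace_growth X a c).1 (interlace_growth X a c).2]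

lemma eq_of_growth_eq {X Y u : ℕ → ℕ → ℕ} {n : ℕ} (huX : ∀ a ≤ n, growth X a (n - a) = u a)
    (huY : ∀ a ≤ n, growth Y a (n - a) = u a)
    (hX : ∀ a < n, ∑ j ∈ Finset.range (n - 1 - a), X a j +
      ∑ j ∈ Finset.range a, X j (n - 1 - a) ≤ 1)
    (hY : ∀ a < n, ∑ j ∈ Finset.range (n - 1 - a), Y a j +
      ∑ j ∈ Finset.range a, Y j (n - 1 - a) ≤ 1) {a c : ℕ} (h : a + c + 2 ≤ n) :
    X a c = Y a c := by
  have key : ∀ a c, a + c ≤ n → growth X a c = growth Y a c := fun a c h => by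
    rw [growth_eq_shrink huX hX (n - a - c) a c (by omega),
      growth_eq_shrink huY hY (n - a - c) a c (by omega)]
  have h1 := congrFun (key (a + 1) (c + 1) (by omega)) 0
  rw [growth_succ_succ, growth_succ_succ, key a c (by omega), key (a + 1) c (by omega),
    key a (c + 1) (by omega), localRule, localRule] at h1
  omega

lemma interlace_shrink {u : ℕ → ℕ → ℕ} {n : ℕ} (hu : ∀ a < n, NearShape (u a) (u (a + 1)))
    (hanti : ∀ a, Antitone (u a)) {d a : ℕ} (h : a + d + 1 ≤ n) :
    Interlace (shrink u (d + 1) a) (shrink u d a) ∧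
      Interlace (shrink u (d + 1) a) (shrink u d (a + 1)) := by
  induction d generalizing a with
  | zero => exact (hu a (by omega)).interlace (hanti a) (hanti (a + 1))
  | succ d ih =>
    rw [shrink]
    exact ((ih (a := a + 1) (by omega)).1.backRule (ih (a := a) (by omega)).2).symm

/-- The matrix whose growth diagram has outer boundary `u`. -/
def boundaryMatrix (u : ℕ → ℕ → ℕ) (n a c : ℕ) : ℕ :=
  if a + c + 2 ≤ n then
    shrink u (n - 2 - a - c) (a + 1) 0 -
      max (shrink u (n - 1 - a - c) (a + 1) 0) (shrink u (n - 1 - a - c) a 0)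
  else 0

lemma growth_boundaryMatrix {u : ℕ → ℕ → ℕ} {n : ℕ}
    (hu : ∀ a < n, NearShape (u a) (u (a + 1))) (hanti : ∀ a, Antitone (u a)) (h0 : u 0 = 0)
    (hn : u n = 0) (a c : ℕ) (h : a + c ≤ n) :
    growth (boundaryMatrix u n) a c = shrink u (n - a - c) a := by
  have hle : ∀ {f g : ℕ → ℕ}, Interlace f g → g = 0 → f = 0 := by
    rintro f _ hfg rfl
    exact funext fun i => Nat.le_zero.1 (hfg i).1
  induction a generalizing c with
  | zero =>
    have key : ∀ d ≤ n, shrink u d 0 = 0 := fun d => by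
      induction d with
      | zero => exact fun _ => h0
      | succ d ih => exact fun hd => hle (interlace_shrink hu hanti (by omega)).1 (ih (by omega))
    rw [growth_zero_left, key _ (by omega)]
  | succ a iha =>
    induction c with
    | zero =>
      have key : ∀ d a, a + d = n → shrink u d a = 0 := fun d => by
        induction d with
        | zero =>
          rintro a rfl
          exact hn
        | succ d ih =>
          exact fun a ha => hle (interlace_shrink hu hanti (by omega)).2 (ih _ (by omega))
      rw [growth_zero_right, key _ _ (by omega)]
    | succ c ihc =>
      obtain ⟨d, rfl⟩ : ∃ d, n = a + c + d + 2 := ⟨n - a - c - 2, by omega⟩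
      rw [growth_succ_succ, iha c (by omega), iha (c + 1) (by omega), ihc (by omega),
        boundaryMatrix, if_pos (by omega), show a + c + d + 2 - 2 - a - c = d by omega,
        show a + c + d + 2 - 1 - a - c = d + 1 by omega,
        show a + c + d + 2 - a - c = d + 2 by omega,
        show a + c + d + 2 - (a + 1) - c = d + 1 by omega,
        show a + c + d + 2 - a - (c + 1) = d + 1 by omega,
        show a + c + d + 2 - (a + 1) - (c + 1) = d by omega, shrink]
      exact localRule_backRule (interlace_shrink hu hanti (by omega)).1
        (interlace_shrink hu hanti (by omega)).2

lemma sum_boundaryMatrix_le {u : ℕ → ℕ → ℕ} {n : ℕ}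
    (hu : ∀ a < n, NearShape (u a) (u (a + 1))) (hanti : ∀ a, Antitone (u a)) (h0 : u 0 = 0)
    (hn : u n = 0) {a : ℕ} (ha : a < n) :
    ∑ j ∈ Finset.range (n - 1 - a), boundaryMatrix u n a j +
      ∑ j ∈ Finset.range a, boundaryMatrix u n j (n - 1 - a) ≤ 1 := by
  have hl := boxes_growth_succ_left (boundaryMatrix u n) (le_refl (a + 1)) (n - 1 - a)
  have hr := boxes_growth_succ_right (boundaryMatrix u n) (Nat.le_add_right a 1) (n - 1 - a)
  rw [growth_boundaryMatrix hu hanti h0 hn _ _ (by omega),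
    growth_boundaryMatrix hu hanti h0 hn _ _ (by omega),
    show n - a - (n - 1 - a) = 1 by omega] at hl hr
  rw [show n - (a + 1) - (n - 1 - a) = 0 by omega] at hl
  rw [show n - a - (n - 1 - a + 1) = 0 by omega] at hr
  have := (hu a ha).boxes (a + 1)
  simp only [shrink] at hl hr
  omega

section arcs

variable {n : ℕ}

/-- The indicator matrix of the pairs `a < τ a`, with columns numbered from the right. -/
def arcs (τ : Equiv.Perm (Fin n)) (a c : ℕ) : ℕ :=
  if ∃ v : Fin n, (v : ℕ) = a ∧ v < τ v ∧ (τ v : ℕ) + c + 1 = n then 1 else 0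

lemma arcs_le_one (τ : Equiv.Perm (Fin n)) (a c : ℕ) : arcs τ a c ≤ 1 := by
  rw [arcs]
  split_ifs <;> omega

lemma arcs_ne_zero_iff {τ : Equiv.Perm (Fin n)} {a c : ℕ} :
    arcs τ a c ≠ 0 ↔ ∃ v : Fin n, (v : ℕ) = a ∧ v < τ v ∧ (τ v : ℕ) + c + 1 = n := by
  rw [arcs]
  split_ifs with h <;> simp [h]

lemma hasChain_of_le_growth_arcs {τ : Equiv.Perm (Fin n)} {k a c : ℕ}
    (h : k ≤ growth (arcs τ) a c 0) : HasChain (arcs τ) k a c := by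
  refine hasChain_of_le_growth (arcs_le_one τ) (fun a c c' h h' => ?_) (fun a a' c h h' => ?_) h <;>
    obtain ⟨v, rfl, -, hv⟩ := arcs_ne_zero_iff.1 h <;>
    obtain ⟨v', hv', -, hw⟩ := arcs_ne_zero_iff.1 h'
  · rw [Fin.ext hv'] at hw
    omega
  · rw [← hv', τ.injective (Fin.ext (by omega : (τ v : ℕ) = τ v'))]

lemma sum_arcs_row (τ : Equiv.Perm (Fin n)) (v : Fin n) :
    ∑ j ∈ Finset.range (n - 1 - v), arcs τ v j = if v < τ v then 1 else 0 := by
  have key : ∀ j, arcs τ v j = if v < τ v ∧ (τ v : ℕ) + j + 1 = n then 1 else 0 := fun j => by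
    rw [arcs]
    refine if_congr ⟨?_, fun h => ⟨v, rfl, h⟩⟩ rfl rfl
    rintro ⟨v', hv', h⟩
    rwa [Fin.ext hv'] at h
  simp only [key]
  split_ifs with h
  · rw [Finset.sum_eq_single (n - 1 - τ v)]
    · have := (τ v).2
      rw [if_pos ⟨h, by omega⟩]
    · intro j _ hj
      rw [if_neg]
      omega
    · have := (τ v).2
      rw [Fin.lt_def] at h
      simp only [Finset.mem_range]
      omega
  · exact Finset.sum_eq_zero fun j _ => if_neg fun h' => h h'.1

lemma sum_arcs_col {τ : Equiv.Perm (Fin n)} (hτ : Function.Involutive τ) (v : Fin n) :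
    ∑ j ∈ Finset.range v, arcs τ j (n - 1 - v) = if τ v < v then 1 else 0 := by
  have key : ∀ j, arcs τ j (n - 1 - v) = if τ v < v ∧ (τ v : ℕ) = j then 1 else 0 := fun j => by
    rw [arcs]
    refine if_congr ⟨?_, fun h => ⟨τ v, h.2, by rw [hτ v]; exact h.1, by rw [hτ v]; omega⟩⟩ rfl rfl
    rintro ⟨w, rfl, h, hw⟩
    obtain rfl : τ w = v := Fin.ext (by omega)
    rw [hτ w]
    exact ⟨h, rfl⟩
  simp only [key]
  split_ifs with h
  · rw [Finset.sum_eq_single (τ v : ℕ)]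
    · rw [if_pos ⟨h, rfl⟩]
    · intro j _ hj
      rw [if_neg]
      exact fun h' => hj h'.2.symm
    · exact fun h' => absurd (Finset.mem_range.2 h) h'
  · exact Finset.sum_eq_zero fun j _ => if_neg fun h' => h h'.1

lemma sum_arcs_le {τ : Equiv.Perm (Fin n)} (hτ : Function.Involutive τ) {a : ℕ} (ha : a < n) :
    ∑ j ∈ Finset.range (n - 1 - a), arcs τ a j +
      ∑ j ∈ Finset.range a, arcs τ j (n - 1 - a) ≤ 1 := by
  have h1 := sum_arcs_row τ ⟨a, ha⟩
  have h2 := sum_arcs_col hτ ⟨a, ha⟩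
  dsimp only at h1 h2
  rw [h1, h2]
  split_ifs with h h'
  · exact absurd h h'.asymm
  all_goals omega

lemma eq_of_arcs_eq {τ τ' : Equiv.Perm (Fin n)} (hτ : Function.Involutive τ)
    (hτ' : Function.Involutive τ') (h : ∀ a c, a + c + 2 ≤ n → arcs τ a c = arcs τ' a c) :
    τ = τ' := by
  have key : ∀ {τ τ' : Equiv.Perm (Fin n)}, (∀ a c, a + c + 2 ≤ n → arcs τ a c = arcs τ' a c) →
      ∀ v, v < τ v → τ v = τ' v := fun {τ τ'} h v hv => by
    have h2 := (τ v).2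
    have h1 : arcs τ v (n - 1 - τ v) ≠ 0 := arcs_ne_zero_iff.2 ⟨v, rfl, hv, by omega⟩
    rw [Fin.lt_def] at hv
    rw [h _ _ (by omega)] at h1
    obtain ⟨w, hw, -, hn⟩ := arcs_ne_zero_iff.1 h1
    rw [Fin.ext hw] at hn
    exact Fin.ext (by omega)
  have key2 : ∀ {τ τ' : Equiv.Perm (Fin n)}, Function.Involutive τ → Function.Involutive τ' →
      (∀ a c, a + c + 2 ≤ n → arcs τ a c = arcs τ' a c) → ∀ v, τ v ≠ v → τ v = τ' v := by
    intro τ τ' hτ hτ' h v hv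
    rcases lt_or_gt_of_ne hv with hlt | hlt
    · have := key h (τ v) (by rwa [hτ v])
      rw [hτ v] at this
      conv_rhs => rw [this, hτ']
    · exact key h v hlt
  refine Equiv.ext fun v => ?_
  by_cases hv : τ v = v
  · by_cases hv' : τ' v = v
    · rw [hv, hv']
    · exact (key2 hτ' hτ (fun a c hac => (h a c hac).symm) v hv').symm
  · exact key2 hτ hτ' h v hv

lemma exists_arcs_eq {X : ℕ → ℕ → ℕ} (h0 : ∀ a c, n < a + c + 2 → X a c = 0)
    (hX : ∀ a < n, ∑ j ∈ Finset.range (n - 1 - a), X a j +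
      ∑ j ∈ Finset.range a, X j (n - 1 - a) ≤ 1) :
    ∃ τ : Equiv.Perm (Fin n), Function.Involutive τ ∧ arcs τ = X := by
  have hrow : ∀ a c, a + c + 2 ≤ n → X a c ≤ ∑ j ∈ Finset.range (n - 1 - a), X a j :=
    fun a c h => Finset.single_le_sum (f := fun j => X a j) (fun _ _ => Nat.zero_le _)
      (Finset.mem_range.2 (by omega))
  have hcol : ∀ a b, a < b → X a (n - 1 - b) ≤ ∑ j ∈ Finset.range b, X j (n - 1 - b) :=
    fun a b h => Finset.single_le_sum (f := fun j => X j (n - 1 - b)) (fun _ _ => Nat.zero_le _)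
      (Finset.mem_range.2 h)
  have hrow2 : ∀ a c c', a + c + 2 ≤ n → a + c' + 2 ≤ n → X a c ≠ 0 → X a c' ≠ 0 → c = c' := by
    intro a c c' h h' hc hc'
    by_contra hne
    have h1 := Finset.add_le_sum (f := fun j => X a j) (fun _ _ => Nat.zero_le _)
      (Finset.mem_range.2 (by omega : c < n - 1 - a)) (Finset.mem_range.2 (by omega)) hne
    have := hX a (by omega)
    omega
  have hcol2 : ∀ a a' b, b < n → a < b → a' < b → X a (n - 1 - b) ≠ 0 → X a' (n - 1 - b) ≠ 0 →
      a = a' := by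
    intro a a' b hb h h' hc hc'
    by_contra hne
    have h1 := Finset.add_le_sum (f := fun j => X j (n - 1 - b)) (fun _ _ => Nat.zero_le _)
      (Finset.mem_range.2 h) (Finset.mem_range.2 h') hne
    have := hX b hb
    omega
  have hmix : ∀ a b c, a < b → b + c + 2 ≤ n → X a (n - 1 - b) ≠ 0 → X b c ≠ 0 → False := by
    intro a b c h h' hc hc'
    have h1 := hrow b c h'
    have h2 := hcol a b h
    have := hX b (by omega)
    omega
  let Q : Fin n → Fin n → Prop := fun a b =>
    (a < b ∧ X a (n - 1 - b) ≠ 0) ∨ (b < a ∧ X b (n - 1 - a) ≠ 0)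
  have hsymm : ∀ a b, Q a b → Q b a := fun a b h => h.symm
  have huniq : ∀ a b b', Q a b → Q a b' → b = b' := by
    intro a b b' h h'
    have ha := a.2
    have hb := b.2
    have hb' := b'.2
    simp only [Q, Fin.lt_def] at h h'
    rcases h with ⟨h, hx⟩ | ⟨h, hx⟩ <;> rcases h' with ⟨h', hx'⟩ | ⟨h', hx'⟩
    · have := hrow2 _ _ _ (by omega) (by omega) hx hx'
      exact Fin.ext (by omega)
    · exact (hmix _ _ _ h' (by omega) hx' hx).elim
    · exact (hmix _ _ _ h (by omega) hx hx').elim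
    · exact Fin.ext (hcol2 _ _ _ ha h h' hx hx')
  let τ : Fin n → Fin n := fun a => if h : ∃ b, Q a b then h.choose else a
  have hτ : ∀ a b, Q a b → τ a = b := fun a b h => by
    have h' : ∃ b, Q a b := ⟨b, h⟩
    simp only [τ, dif_pos h']
    exact huniq _ _ _ h'.choose_spec h
  have hτ' : ∀ a, τ a = a ∨ Q a (τ a) := fun a => by
    by_cases h : ∃ b, Q a b
    · right
      simp only [τ, dif_pos h]
      exact h.choose_spec
    · left
      simp only [τ, dif_neg h]
  have hinv : Function.Involutive τ := fun a => by
    rcases hτ' a with h | h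
    · rw [h, h]
    · exact hτ _ _ (hsymm _ _ h)
  refine ⟨hinv.toPerm, hinv, ?_⟩
  funext a c
  have hiff : arcs hinv.toPerm a c ≠ 0 ↔ X a c ≠ 0 := by
    rw [arcs_ne_zero_iff]
    constructor
    · rintro ⟨v, rfl, hv, hc⟩
      rw [Function.Involutive.coe_toPerm] at hv hc
      rcases hτ' v with h | ⟨-, h⟩ | ⟨h, -⟩
      · exact absurd h hv.ne'
      · rwa [show n - 1 - τ v = c by omega] at h
      · exact absurd h hv.asymm
    · intro h
      have hac : a + c + 2 ≤ n := by
        by_contra hac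
        exact h (h0 a c (by omega))
      have hQ : Q ⟨a, by omega⟩ ⟨n - 1 - c, by omega⟩ :=
        Or.inl ⟨by rw [Fin.lt_def]; dsimp only; omega, by rwa [show n - 1 - (n - 1 - c) = c by omega]⟩
      refine ⟨⟨a, by omega⟩, rfl, ?_⟩
      rw [Function.Involutive.coe_toPerm, hτ _ _ hQ, Fin.lt_def]
      dsimp only
      omega
  have h1 := arcs_le_one hinv.toPerm a c
  by_cases h : X a c = 0
  · rw [h]
    by_contra h'
    exact hiff.1 h' h
  · have h2 := hiff.2 h
    have hac : a + c + 2 ≤ n := by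
      by_contra hac
      exact h (h0 a c (by omega))
    have := hrow a c hac
    have := hX a (by omega)
    omega

end arcs

section descents

variable {n : ℕ} {τ : Equiv.Perm (Fin n)}

lemma hasDescSeq_iff_exists_list {f : Fin n → Fin n} {k : ℕ} :
    HasDescSeq f k ↔ ∃ l : List (Fin n), l.length = k ∧
      l.Pairwise fun a b => a < b ∧ f b < f a := by
  constructor
  · rintro ⟨s, hs, hf⟩
    exact ⟨List.ofFn s, List.length_ofFn, List.pairwise_ofFn.2 fun i j h => ⟨hs h, hf h⟩⟩
  · rintro ⟨l, rfl, h⟩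
    rw [List.pairwise_iff_get] at h
    exact ⟨l.get, fun i j hij => (h i j hij).1, fun i j hij => (h i j hij).2⟩

lemma exists_list_of_hasChain {k v c : ℕ} (h : HasChain (arcs τ) k v c) :
    ∃ l : List (Fin n), l.length = k ∧ (l.Pairwise fun a b => a < b ∧ τ b < τ a) ∧
      ∀ a ∈ l, (a : ℕ) < v ∧ n ≤ τ a + c := by
  induction k generalizing v c with
  | zero => exact ⟨[], rfl, List.Pairwise.nil, by simp⟩
  | succ k ih =>
    obtain ⟨p, hp, q, hq, hX, h⟩ := h
    obtain ⟨w, rfl, hw, hn⟩ := arcs_ne_zero_iff.1 hX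
    obtain ⟨l, hl, hl', hmem⟩ := ih h
    refine ⟨l ++ [w], by simp [hl], ?_, ?_⟩
    · refine List.pairwise_append.2 ⟨hl', List.pairwise_singleton _ _, fun a ha b hb => ?_⟩
      obtain rfl := List.mem_singleton.1 hb
      have := hmem a ha
      simp only [Fin.lt_def]
      omega
    · intro a ha
      rcases List.mem_append.1 ha with ha | ha
      · have := hmem a ha
        omega
      · obtain rfl := List.mem_singleton.1 ha
        omega

lemma hasDescSeq_iff_hasChain (hτ : Function.Involutive τ) (ℓ : ℕ) :
    HasDescSeq τ (2 * ℓ + 1) ↔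
      ∃ v : Fin n, v ≤ τ v ∧ HasChain (arcs τ) ℓ v (n - 1 - τ v) := by
  constructor
  · have key : ∀ s : Fin (2 * ℓ + 1) → Fin n, StrictMono s → StrictAnti (fun a => τ (s a)) →
        s ⟨ℓ, by omega⟩ ≤ τ (s ⟨ℓ, by omega⟩) →
        ∃ v : Fin n, v ≤ τ v ∧ HasChain (arcs τ) ℓ v (n - 1 - τ v) := by
      intro s hs hs' hm
      refine ⟨_, hm, ?_⟩
      have h : ∀ k (hk : k ≤ ℓ), HasChain (arcs τ) k (s ⟨k, by omega⟩)
          (n - 1 - τ (s ⟨k, by omega⟩)) := by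
        intro k hk
        induction k with
        | zero => trivial
        | succ k ih =>
          have h1 : s ⟨k, by omega⟩ < s ⟨k + 1, by omega⟩ := hs (Fin.lt_def.2 (Nat.lt_succ_self k))
          have h2 : τ (s ⟨k + 1, by omega⟩) < τ (s ⟨k, by omega⟩) :=
            hs' (Fin.lt_def.2 (Nat.lt_succ_self k))
          have h3 : s ⟨k + 1, by omega⟩ ≤ s ⟨ℓ, by omega⟩ := hs.monotone (Fin.le_def.2 hk)
          have h4 : τ (s ⟨ℓ, by omega⟩) ≤ τ (s ⟨k + 1, by omega⟩) :=
            hs'.antitone (Fin.le_def.2 hk)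
          have h5 := (τ (s ⟨k, by omega⟩)).2
          refine ⟨_, h1, n - 1 - τ (s ⟨k, by omega⟩), by omega, ?_, ih (by omega)⟩
          exact arcs_ne_zero_iff.2 ⟨_, rfl, by omega, by omega⟩
      exact h ℓ le_rfl
    rintro ⟨s, hs, hs'⟩
    rcases le_total (s ⟨ℓ, by omega⟩) (τ (s ⟨ℓ, by omega⟩)) with h | h
    · exact key s hs hs' h
    · have hrev : Fin.rev (⟨ℓ, by omega⟩ : Fin (2 * ℓ + 1)) = ⟨ℓ, by omega⟩ :=
        Fin.ext (by rw [Fin.val_rev]; dsimp only; omega)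
      refine key (fun i => τ (s i.rev)) (fun i j hij => hs' (Fin.rev_lt_rev.2 hij))
        (fun i j hij => ?_) ?_
      · simp only [hτ _]
        exact hs (Fin.rev_lt_rev.2 hij)
      · simp only [hτ _, hrev]
        exact h
  · rintro ⟨v, hv, h⟩
    obtain ⟨l, hl, hl', hmem⟩ := exists_list_of_hasChain h
    have hmem' : ∀ a ∈ l, a < v ∧ τ v < τ a := fun a ha => by
      have := hmem a ha
      have := (τ v).2
      omega
    refine hasDescSeq_iff_exists_list.2 ⟨l ++ v :: (l.map τ).reverse, by simp [hl]; omega, ?_⟩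
    refine List.pairwise_append.2 ⟨hl', List.pairwise_cons.2 ⟨?_, ?_⟩, ?_⟩
    · intro b hb
      obtain ⟨a, ha, rfl⟩ := List.mem_map.1 (List.mem_reverse.1 hb)
      rw [hτ a]
      have := hmem' a ha
      omega
    · rw [List.pairwise_reverse, List.pairwise_map]
      refine hl'.imp fun {a b} hab => ?_
      rw [hτ a, hτ b]
      exact hab.symm
    · intro a ha b hb
      have h1 := hmem' a ha
      rcases List.mem_cons.1 hb with rfl | hb
      · exact h1
      · obtain ⟨b', hb', rfl⟩ := List.mem_map.1 (List.mem_reverse.1 hb)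
        have h2 := hmem' b' hb'
        rw [hτ b']
        omega

lemma growth_arcs_succ_left {v : Fin n} (h : ¬ v < τ v) :
    growth (arcs τ) (v + 1) (n - 1 - v) = growth (arcs τ) v (n - 1 - v) :=
  (interlace_growth _ _ _).1.eq_of_boxes_eq (fun _ hi => growth_eq_zero _ hi _) <| by
    rw [boxes_growth_succ_left _ le_rfl, sum_arcs_row, if_neg h, add_zero]

lemma growth_arcs_succ_right (hτ : Function.Involutive τ) {v : Fin n} (h : ¬ τ v < v) :
    growth (arcs τ) v (n - 1 - v + 1) = growth (arcs τ) v (n - 1 - v) :=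
  (interlace_growth _ _ _).2.eq_of_boxes_eq (fun _ hi => growth_eq_zero _ hi _) <| by
    rw [boxes_growth_succ_right _ le_rfl, sum_arcs_col hτ, if_neg h, add_zero]

lemma not_hasDescSeq_iff (hτ : Function.Involutive τ) (ℓ : ℕ) :
    ¬ HasDescSeq τ (2 * ℓ + 1) ↔ (∀ a ≤ n, growth (arcs τ) a (n - a) 0 ≤ ℓ) ∧
      ∀ v : Fin n, τ v = v → growth (arcs τ) v (n - v) 0 < ℓ := by
  rw [hasDescSeq_iff_hasChain hτ]
  constructor
  · refine fun h => ⟨fun a ha => ?_, fun v hv => ?_⟩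
    · by_contra! hlt
      obtain ⟨p, hp, q, hq, hX, hc⟩ := hasChain_of_le_growth_arcs (Nat.succ_le_of_lt hlt)
      obtain ⟨w, rfl, hw, hn⟩ := arcs_ne_zero_iff.1 hX
      exact h ⟨w, hw.le, hc.mono le_rfl (by omega)⟩
    · by_contra! hle
      refine h ⟨v, hv.ge, ?_⟩
      rw [show n - (v : ℕ) = n - 1 - v + 1 by omega,
        growth_arcs_succ_right hτ (by rw [hv]; exact lt_irrefl _)] at hle
      rw [hv]
      exact hasChain_of_le_growth_arcs hle
  · rintro ⟨h1, h2⟩ ⟨v, hv, hc⟩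
    rcases hv.eq_or_lt with hv | hv
    · have := h2 v hv.symm
      have := (hc.mono le_rfl (show n - 1 - (τ v : ℕ) ≤ n - v by omega)).le_growth
      omega
    · have h3 : HasChain (arcs τ) (ℓ + 1) (v + 1) (n - τ v) :=
        ⟨v, Nat.lt_succ_self _, n - 1 - τ v, by omega,
          arcs_ne_zero_iff.2 ⟨v, rfl, hv, by omega⟩, hc⟩
      have h4 := (h3.mono le_rfl (show n - (τ v : ℕ) ≤ n - (v + 1) by omega)).le_growth
      have := h1 (v + 1) (by omega)
      omega

end descents

lemma boundary_step {n : ℕ} {τ : Equiv.Perm (Fin n)} (hτ : Function.Involutive τ) (v : Fin n) :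
    (v < τ v ∧ ∃ i, growth (arcs τ) (v + 1) (n - (v + 1)) = Function.update
      (growth (arcs τ) v (n - v)) i (growth (arcs τ) v (n - v) i + 1)) ∨
    (τ v < v ∧ ∃ i, growth (arcs τ) v (n - v) = Function.update
      (growth (arcs τ) (v + 1) (n - (v + 1))) i (growth (arcs τ) (v + 1) (n - (v + 1)) i + 1)) ∨
    (τ v = v ∧ growth (arcs τ) v (n - v) = growth (arcs τ) (v + 1) (n - (v + 1))) := by
  rw [show n - (v : ℕ) = n - 1 - v + 1 by omega, show n - ((v : ℕ) + 1) = n - 1 - v by omega]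
  rcases lt_trichotomy v (τ v) with h | h | h
  · refine Or.inl ⟨h, ?_⟩
    rw [growth_arcs_succ_right hτ h.asymm]
    refine (interlace_growth _ _ _).1.exists_eq_update (fun _ hi => growth_eq_zero _ hi _) ?_
    rw [boxes_growth_succ_left _ le_rfl, sum_arcs_row, if_pos h]
  · refine Or.inr (Or.inr ⟨h.symm, ?_⟩)
    rw [growth_arcs_succ_right hτ (by rw [← h]; exact lt_irrefl _),
      growth_arcs_succ_left (by rw [← h]; exact lt_irrefl _)]
  · refine Or.inr (Or.inl ⟨h, ?_⟩)
    rw [growth_arcs_succ_left h.asymm]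
    refine (interlace_growth _ _ _).2.exists_eq_update (fun _ hi => growth_eq_zero _ hi _) ?_
    rw [boxes_growth_succ_right _ le_rfl, sum_arcs_col hτ, if_pos h]

lemma update_add_one_ne (f : ℕ → ℕ) (i : ℕ) : f ≠ Function.update f i (f i + 1) := fun h => by
  have := congrFun h i
  rw [Function.update_self] at this
  omega

/-- The walk of partitions along the outer boundary of the growth diagram of an involution. -/
def boundaryWalk {n ℓ : ℕ} (τ : {τ : Equiv.Perm (Fin n) //
    Function.Involutive τ ∧ ¬ HasDescSeq τ (2 * ℓ + 1)}) :
    {w : Fin (n + 1) → BddShape ℓ // w 0 = BddShape.empty ℓ ∧ w (Fin.last n) = BddShape.empty ℓ ∧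
      ∀ i : Fin n, BddShape.Step (w i.castSucc) (w i.succ)} :=
  ⟨fun a => ⟨growth (arcs τ.1) a (n - a), antitone_growth _ _ _, ⟨a, growth_eq_zero _ le_rfl _⟩,
      ((not_hasDescSeq_iff τ.2.1 ℓ).1 τ.2.2).1 a (Nat.lt_succ_iff.1 a.2)⟩,
    Subtype.ext (growth_zero_left _ _),
    Subtype.ext (by simp only [Fin.val_last, Nat.sub_self]; exact growth_zero_right _ _),
    fun v => by
      rcases boundary_step τ.2.1 v with ⟨-, h⟩ | ⟨-, h⟩ | ⟨h, h'⟩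
      · exact Or.inl h
      · exact Or.inr (Or.inl h)
      · exact Or.inr (Or.inr ⟨Subtype.ext h', ((not_hasDescSeq_iff τ.2.1 ℓ).1 τ.2.2).2 v h⟩)⟩

lemma boundaryWalk_injective (n ℓ : ℕ) : Function.Injective (boundaryWalk (n := n) (ℓ := ℓ)) := by
  intro τ τ' h
  refine Subtype.ext (eq_of_arcs_eq τ.2.1 τ'.2.1 fun a c hac => ?_)
  refine eq_of_growth_eq (u := fun a => growth (arcs τ.1) a (n - a)) (fun _ _ => rfl)
    (fun a ha => ?_) (fun a ha => sum_arcs_le τ.2.1 ha) (fun a ha => sum_arcs_le τ'.2.1 ha) hac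
  exact (congrArg Subtype.val (congrFun (congrArg Subtype.val h) ⟨a, Nat.lt_succ_iff.2 ha⟩)).symm

lemma boundaryWalk_surjective (n ℓ : ℕ) :
    Function.Surjective (boundaryWalk (n := n) (ℓ := ℓ)) := by
  rintro ⟨w, hw0, hwn, hw⟩
  obtain ⟨u, hu⟩ : ∃ u : ℕ → ℕ → ℕ, u = fun a => (w ⟨min a n, by omega⟩).1 := ⟨_, rfl⟩
  have huw : ∀ a (ha : a < n + 1), u a = (w ⟨a, ha⟩).1 := fun a ha => by
    simp only [hu, min_eq_left (Nat.lt_succ_iff.1 ha)]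
  have hanti : ∀ a, Antitone (u a) := fun a => by
    rw [hu]
    exact (w _).2.1
  have h0 : u 0 = 0 := by
    rw [huw 0 (by omega)]
    exact congrArg Subtype.val hw0
  have hn : u n = 0 := by
    rw [huw n (by omega)]
    exact congrArg Subtype.val hwn
  have hnear : ∀ a < n, NearShape (u a) (u (a + 1)) := fun a ha => by
    rw [huw a (by omega), huw (a + 1) (by omega)]
    exact (hw ⟨a, ha⟩).imp_right (Or.imp_right fun h => congrArg Subtype.val h.1)
  obtain ⟨τ, hτ, harcs⟩ := exists_arcs_eq (n := n) (X := boundaryMatrix u n)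
    (fun a c h => if_neg (by omega)) (fun a ha => sum_boundaryMatrix_le hnear hanti h0 hn ha)
  have hgrowth : ∀ a (ha : a < n + 1), growth (arcs τ) a (n - a) = (w ⟨a, ha⟩).1 := fun a ha => by
    rw [harcs, growth_boundaryMatrix hnear hanti h0 hn _ _ (by omega), Nat.sub_self, shrink,
      huw a ha]
  have hvalid : ¬ HasDescSeq τ (2 * ℓ + 1) := by
    refine (not_hasDescSeq_iff hτ ℓ).2 ⟨fun a ha => ?_, fun v hv => ?_⟩
    · rw [hgrowth a (by omega)]
      exact (w _).2.2.2
    · rcases boundary_step hτ v with ⟨h, -⟩ | ⟨h, -⟩ | ⟨-, h⟩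
      · exact absurd hv h.ne'
      · exact absurd hv h.ne
      · rw [hgrowth v (by omega), hgrowth (v + 1) (by omega)] at h
        rw [hgrowth v (by omega)]
        rcases hw v with ⟨i, h'⟩ | ⟨i, h'⟩ | ⟨-, h'⟩
        · exact (update_add_one_ne _ i (h.trans h')).elim
        · exact (update_add_one_ne _ i (h.symm.trans h')).elim
        · exact h'
  exact ⟨⟨τ, hτ, hvalid⟩, Subtype.ext (funext fun a => Subtype.ext (hgrowth a a.2))⟩

lemma invCount_eq_walkCount (n ℓ : ℕ) : invCount (2 * ℓ) n =
    walkCount BddShape.Step n (BddShape.empty ℓ) (BddShape.empty ℓ) :=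
  Nat.card_congr (Equiv.ofBijective _ ⟨boundaryWalk_injective n ℓ, boundaryWalk_surjective n ℓ⟩)

/-- For `m = 2ℓ`: `∑_{n≥0} i_n^{(m)} t^n/n! = det(I_{i−j} + I_{i+j−1})_{1≤i,j≤ℓ}`.
With 0-based indices `i,j : Fin ℓ`, the entry is `I_{i−j} + I_{i+j+1}`. -/
theorem invCount_egf_even (ℓ : ℕ) (hl : 1 ≤ ℓ) :
    (PowerSeries.mk fun n : ℕ =>
        (invCount (2 * ℓ) n : ℚ) / (Nat.factorial n : ℚ))
      = Matrix.det (Matrix.of fun i j : Fin ℓ =>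
          besselI ((i : ℤ) - (j : ℤ)) + besselI ((i : ℤ) + (j : ℤ) + 1)) := by
  refine PowerSeries.ext fun n => ?_
  have hn : (n.factorial : ℚ) ≠ 0 := Nat.cast_ne_zero.2 n.factorial_ne_zero
  rw [PowerSeries.coeff_mk, invCount_eq_walkCount, walkCount_step hl, mul_div_cancel_left₀ _ hn]
  rfl
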